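/- Let 𝔄 be a C*-algebra and let T : 𝔄 → 𝔄 be a positive linear contraction (i.e. T maps positive elements to positive elements and ‖T‖ ≤ 1). Suppose that the set 𝒟₁ of positive continuous linear functionals ν on 𝔄 admitting a sequence (νₙ)_{n≥0} of positive continuous linear functionals with ν₀ = ν, ‖νₙ‖ ≤ 1 and T*ν_{n+1} = νₙ for all n ≥ 0, contains only functionals ν with ν(x) = 0 for a given positive element x ∈ 𝔄. Then ‖Tⁿ x‖ → 0 as n → ∞. -/

import Mathlib

open Filter Topology
open scoped ComplexOrder

section Unital

variable {B : Type*} [CStarAlgebra B]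

theorem IsSelfAdjoint.norm_add_I_smul_one_sq_le [Nontrivial B] {h : B} (hh : IsSelfAdjoint h) (t : ℝ) :
    ‖h + ((t : ℂ) * Complex.I) • (1 : B)‖ ^ 2 ≤ ‖h‖ ^ 2 + t ^ 2 := by
  have key : star (h + ((t : ℂ) * Complex.I) • (1 : B)) * (h + ((t : ℂ) * Complex.I) • (1 : B))
      = h * h + ((t ^ 2 : ℝ) : ℂ) • (1 : B) := by
    have hI : -((t : ℂ) * Complex.I * (t * Complex.I)) = ((t ^ 2 : ℝ) : ℂ) := by
      push_cast
      linear_combination (-(t : ℂ) ^ 2) * Complex.I_sq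
    rw [← hI]
    simp only [star_add, star_smul, star_one, hh.star_eq, star_mul', Complex.star_def,
      Complex.conj_ofReal, Complex.conj_I, add_mul, mul_add, smul_mul_assoc, mul_smul_comm,
      one_mul, mul_one, smul_smul, smul_add, smul_neg, neg_smul, neg_mul, mul_neg]
    abel
  rw [sq, ← CStarRing.norm_star_mul_self, key]
  refine (norm_add_le _ _).trans (add_le_add ((norm_mul_le _ _).trans (sq _).ge) ?_)
  rw [norm_smul, norm_one, mul_one, Complex.norm_real, Real.norm_of_nonneg (sq_nonneg t)]

variable [PartialOrder B] [StarOrderedRing B]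

theorem CStarAlgebra.norm_one_add_of_nonneg [Nontrivial B] {a : B} (ha : 0 ≤ a) :
    ‖1 + a‖ = 1 + ‖a‖ := by
  refine le_antisymm ((norm_add_le _ _).trans (by simp)) ?_
  have h1 : (0 : B) ≤ 1 := zero_le_one
  have h1a : (0 : B) ≤ 1 + a := add_nonneg h1 ha
  have hr : 1 ≤ ‖1 + a‖ := by
    simpa using CStarAlgebra.norm_le_norm_of_nonneg_of_le h1 (le_add_of_nonneg_right ha)
  have hle : a ≤ algebraMap ℝ B (‖1 + a‖ - 1) := by
    rw [map_sub, map_one, le_sub_iff_add_le, add_comm]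
    exact IsSelfAdjoint.le_algebraMap_norm_self (.of_nonneg h1a)
  have := (CStarAlgebra.norm_le_iff_le_algebraMap a (sub_nonneg.2 hr) ha).2 hle
  linarith

theorem CStarAlgebra.norm_algebraMap_norm_sub_le {b : B} (hb : 0 ≤ b) :
    ‖algebraMap ℝ B ‖b‖ - b‖ ≤ ‖b‖ :=
  (CStarAlgebra.norm_le_iff_le_algebraMap _ (norm_nonneg b)
    (sub_nonneg.2 (IsSelfAdjoint.le_algebraMap_norm_self (.of_nonneg hb)))).2
    (sub_le_self _ hb)

/-- A norm-contractive functional taking the value `1` at the unit is positive. -/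
theorem ContinuousLinearMap.nonneg_of_norm_le_one_of_map_one [Nontrivial B] {g : B →L[ℂ] ℂ}
    (hg : ‖g‖ ≤ 1) (hg1 : g 1 = 1) {b : B} (hb : 0 ≤ b) : 0 ≤ g b := by
  have hre : 0 ≤ (g b).re := by
    have h1 := (g.le_of_opNorm_le hg (algebraMap ℝ B ‖b‖ - b)).trans
      ((one_mul _).le.trans (CStarAlgebra.norm_algebraMap_norm_sub_le hb))
    have h2 : g (algebraMap ℝ B ‖b‖) = (‖b‖ : ℂ) := by
      rw [Algebra.algebraMap_eq_smul_one, ← Complex.coe_smul, map_smul, hg1, smul_eq_mul, mul_one]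
    rw [map_sub, h2] at h1
    have h3 := (Complex.re_le_norm _).trans h1
    simp only [Complex.sub_re, Complex.ofReal_re] at h3
    linarith
  have him : (g b).im = 0 := by
    have h1 (t : ℝ) : ((g b).im + t) ^ 2 ≤ ‖b‖ ^ 2 + t ^ 2 := by
      refine le_trans ?_ ((IsSelfAdjoint.of_nonneg hb).norm_add_I_smul_one_sq_le t)
      have h2 := g.le_of_opNorm_le hg (b + ((t : ℂ) * Complex.I) • (1 : B))
      rw [map_add, map_smul, hg1, one_mul] at h2
      have h3 := (Complex.abs_im_le_norm _).trans h2
      simp only [smul_eq_mul, mul_one, Complex.add_im, Complex.mul_im, Complex.ofReal_re,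
        Complex.I_im, Complex.ofReal_im, Complex.I_re, mul_zero, add_zero] at h3
      exact sq_le_sq.2 (h3.trans (le_abs_self _))
    by_contra hne
    have h2 := h1 (‖b‖ ^ 2 / (g b).im)
    have h3 : (g b).im * (‖b‖ ^ 2 / (g b).im) = ‖b‖ ^ 2 := mul_div_cancel₀ _ hne
    have h4 : 0 < (g b).im ^ 2 := by positivity
    nlinarith [sq_nonneg ‖b‖]
  exact Complex.nonneg_iff.2 ⟨hre, him.symm⟩

theorem CStarAlgebra.exists_norm_le_one_map_one_apply_eq_norm [Nontrivial B] {a : B}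
    (ha : 0 ≤ a) : ∃ g : B →L[ℂ] ℂ, ‖g‖ ≤ 1 ∧ g 1 = 1 ∧ g a = ‖a‖ := by
  obtain ⟨g, hg, hga⟩ := exists_dual_vector'' ℂ (1 + a)
  rw [CStarAlgebra.norm_one_add_of_nonneg ha, map_add] at hga
  have h1 : ‖g 1‖ ≤ 1 := by simpa using g.le_of_opNorm_le hg 1
  have h2 : ‖g a‖ ≤ ‖a‖ := by simpa using g.le_of_opNorm_le hg a
  have hre : (g 1).re + (g a).re = 1 + ‖a‖ := by simpa using congrArg Complex.re hga
  have h1' := (Complex.re_le_norm (g 1)).trans h1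
  have h1e : (g 1).re = 1 := by linarith [(Complex.re_le_norm (g a)).trans h2]
  have hone : g 1 = 1 := by
    have hn : ‖g 1‖ = (g 1).re := le_antisymm (h1.trans h1e.ge) (Complex.re_le_norm _)
    have h0 : 0 ≤ g 1 := Complex.re_eq_norm.1 hn.symm
    exact Complex.ext h1e (by simpa using (Complex.nonneg_iff.1 h0).2.symm)
  refine ⟨g, hg, hone, ?_⟩
  rw [hone] at hga
  simpa using hga

end Unital

/-- Every positive element of a C⋆-algebra is normed by a positive contractive functional. -/
theorem NonUnitalCStarAlgebra.exists_positive_functional_apply_eq_norm {A : Type*}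
    [NonUnitalCStarAlgebra A] [PartialOrder A] [StarOrderedRing A] {a : A} (ha : 0 ≤ a) :
    ∃ φ : A →L[ℂ] ℂ, (∀ y, 0 ≤ y → 0 ≤ φ y) ∧ ‖φ‖ ≤ 1 ∧ φ a = ‖a‖ := by
  obtain ⟨g, hg, hg1, hga⟩ := CStarAlgebra.exists_norm_le_one_map_one_apply_eq_norm
    (Unitization.inr_nonneg_iff.2 ha)
  have hbound (y : A) : ‖g (y : Unitization ℂ A)‖ ≤ 1 * ‖y‖ := by
    simpa [Unitization.norm_inr] using g.le_of_opNorm_le hg (y : Unitization ℂ A)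
  refine ⟨LinearMap.mkContinuous
    (g.toLinearMap ∘ₗ (Unitization.inrNonUnitalAlgHom ℂ A : A →ₗ[ℂ] Unitization ℂ A)) 1 hbound,
    fun y hy ↦ ?_, LinearMap.mkContinuous_norm_le _ zero_le_one _, ?_⟩
  · exact ContinuousLinearMap.nonneg_of_norm_le_one_of_map_one hg hg1
      (Unitization.inr_nonneg_iff.2 hy)
  · exact hga.trans (by rw [Unitization.norm_inr])

/-- Bounded families of functionals converge pointwise along any ultrafilter. -/
theorem Ultrafilter.exists_norm_le_tendsto_apply {ι E : Type*} [NormedAddCommGroup E]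
    [NormedSpace ℂ E] (U : Ultrafilter ι) {r : ℝ} {f : ι → E →L[ℂ] ℂ} (hf : ∀ i, ‖f i‖ ≤ r) :
    ∃ g : E →L[ℂ] ℂ, ‖g‖ ≤ r ∧ ∀ y, Tendsto (fun i ↦ f i y) U (𝓝 (g y)) := by
  obtain ⟨g, hg, hle⟩ := (WeakDual.isCompact_closedBall (𝕜 := ℂ) (E := E) 0 r).ultrafilter_le_nhds'
    (U.map fun i ↦ StrongDual.toWeakDual (f i))
    (Filter.mem_map.2 (Filter.univ_mem' fun i ↦ mem_closedBall_zero_iff.2 (hf i)))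
  refine ⟨WeakDual.toStrongDual g, by simpa using hg, fun y ↦ ?_⟩
  exact ((WeakDual.eval_continuous y).tendsto g).comp hle

/-- If the norms of the iterates of a positive element stay above `c`, then some inverse orbit of
positive contractive functionals takes a value of real part at least `c` at that element. -/
theorem NonUnitalCStarAlgebra.exists_inverse_orbit_le_re_apply {A : Type*}
    [NonUnitalCStarAlgebra A] [PartialOrder A] [StarOrderedRing A] {T : A →L[ℂ] A}
    (hTpos : ∀ x : A, 0 ≤ x → 0 ≤ T x) (hTnorm : ‖T‖ ≤ 1) {x : A} (hx : 0 ≤ x) {c : ℝ}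
    (hc : ∀ n, c ≤ ‖(T ^ n) x‖) :
    ∃ ν : ℕ → (A →L[ℂ] ℂ), (∀ n, ∀ y : A, 0 ≤ y → 0 ≤ ν n y) ∧ (∀ n, ‖ν n‖ ≤ 1) ∧
      (∀ n, (ν (n + 1)).comp T = ν n) ∧ c ≤ (ν 0 x).re := by
  have hpow (n : ℕ) (y : A) (hy : 0 ≤ y) : 0 ≤ (T ^ n) y := by
    induction n with
    | zero => simpa using hy
    | succ n ih => rw [pow_succ']; exact hTpos _ ih
  have hpow_norm (n : ℕ) : ‖T ^ n‖ ≤ 1 := by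
    induction n with
    | zero => exact ContinuousLinearMap.norm_id_le
    | succ n ih =>
      rw [pow_succ]
      exact (norm_mul_le _ _).trans (mul_le_one₀ ih (norm_nonneg _) hTnorm)
  choose φ hφpos hφnorm hφ using fun n ↦
    NonUnitalCStarAlgebra.exists_positive_functional_apply_eq_norm (hpow n x hx)
  have hbound (k n : ℕ) : ‖(φ n).comp (T ^ (n - k))‖ ≤ 1 :=
    ((φ n).opNorm_comp_le _).trans (mul_le_one₀ (hφnorm n) (norm_nonneg _) (hpow_norm _))
  choose ν hνnorm hν using fun k ↦
    (hyperfilter ℕ).exists_norm_le_tendsto_apply (hbound k)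
  refine ⟨ν, fun k y hy ↦ ?_, hνnorm, fun k ↦ ?_, ?_⟩
  · exact ge_of_tendsto' (hν k y) fun n ↦ hφpos n _ (hpow _ y hy)
  · ext y
    refine tendsto_nhds_unique (hν (k + 1) (T y)) ((hν k y).congr' ?_)
    filter_upwards [Nat.hyperfilter_le_atTop (eventually_ge_atTop (k + 1))] with n hn
    have hnk : n - k = n - (k + 1) + 1 := by omega
    simp [hnk, pow_succ]
  · refine ge_of_tendsto' ((Complex.continuous_re.tendsto _).comp (hν 0 x)) fun n ↦ ?_
    have hre : (φ n ((T ^ n) x)).re = ‖(T ^ n) x‖ := congrArg Complex.re (hφ n)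
    exact (hc n).trans hre.ge

theorem norm_iterates_tendsto_zero_of_trivial_inverse_limits
    {A : Type*} [NonUnitalNormedRing A] [StarRing A] [CStarRing A]
    [PartialOrder A] [StarOrderedRing A] [CompleteSpace A]
    [NormedSpace ℂ A] [IsScalarTower ℂ A A] [SMulCommClass ℂ A A] [StarModule ℂ A]
    (T : A →L[ℂ] A)
    (hTpos : ∀ x : A, 0 ≤ x → 0 ≤ T x) (hTnorm : ‖T‖ ≤ 1)
    (x : A) (hx : 0 ≤ x)
    (htrivial : ∀ ν : ℕ → (A →L[ℂ] ℂ),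
      (∀ n, ∀ y : A, 0 ≤ y → 0 ≤ ν n y) →
      (∀ n, ‖ν n‖ ≤ 1) →
      (∀ n, (ν (n + 1)).comp T = ν n) →
      ν 0 x = 0) :
    Tendsto (fun n : ℕ => ‖(T ^ n) x‖) atTop (𝓝 0) := by
  let _ : NonUnitalCStarAlgebra A := {}
  have hanti : Antitone fun n : ℕ ↦ ‖(T ^ n) x‖ := antitone_nat_of_succ_le fun n ↦ by
    rw [pow_succ']
    simpa using T.le_of_opNorm_le hTnorm ((T ^ n) x)
  have hbdd : BddBelow (Set.range fun n : ℕ ↦ ‖(T ^ n) x‖) :=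
    ⟨0, Set.forall_mem_range.2 fun n ↦ norm_nonneg _⟩
  obtain ⟨ν, hpos, hnorm, hcomp, hle⟩ :=
    NonUnitalCStarAlgebra.exists_inverse_orbit_le_re_apply hTpos hTnorm hx (ciInf_le hbdd)
  rw [htrivial ν hpos hnorm hcomp, Complex.zero_re] at hle
  have hzero := hle.antisymm (le_ciInf fun n ↦ norm_nonneg ((T ^ n) x))
  exact hzero ▸ tendsto_atTop_ciInf hanti hbdd
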